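/- arXiv:2408.13475 — 2 statements merged into one kernel-verified Lean document; each statement's English description precedes it below -/
import Mathlib

section
/- Let n ≥ 4 and t ≥ 1 be integers. The U(1) system with parameters (n,3,t) has no nontrivial integer solution if and only if t < n(n−2). -/
/-- The quantity `b(n,k) = (2^⌊k/2⌋/⌈k/2⌉!)·∏_{α=1}^{⌈k/2⌉}(n−k+2α−1)`. -/
def u1B (n k : ℕ) : ℚ :=
  (2 ^ (k / 2) / (Nat.factorial ((k + 1) / 2) : ℚ)) *
    ∏ α ∈ Finset.Icc 1 ((k + 1) / 2), ((n : ℚ) - (k : ℚ) + 2 * (α : ℚ) - 1)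

/-- The U(1) system with parameters `(n,k,t)` on an integer vector `x = (x_0,…,x_n)`. -/
def U1System (n k t : ℕ) (x : ℕ → ℤ) : Prop :=
  (∑ l ∈ Finset.range (n + 1), (n.choose l : ℤ) * |x l| ≤ 2 * (t : ℤ)) ∧
  ∀ j ∈ Finset.range (k + 1),
    ∑ l ∈ Finset.Icc j (n - k + j), ((n - k).choose (l - j) : ℤ) * x l = 0

/-- A vector `x = (x_0,…,x_n)` is nontrivial if some coordinate is nonzero. -/
def U1Nontrivial (n : ℕ) (x : ℕ → ℤ) : Prop :=
  ∃ l ∈ Finset.range (n + 1), x l ≠ 0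

theorem u1_two_choose (m : ℕ) : 2 * (((m + 1).choose 2 : ℕ) : ℤ) = ((m : ℤ) + 1) * m := by
  have h := Nat.add_one_mul_choose_eq m 1
  rw [Nat.choose_one_right] at h
  have h' : (((m + 1) * m : ℕ) : ℤ) = (((m + 1).choose (1 + 1) * (1 + 1) : ℕ) : ℤ) := by rw [h]
  push_cast at h'
  linarith

theorem u1_six_choose (m : ℕ) :
    6 * (((m + 2).choose 3 : ℕ) : ℤ) = ((m : ℤ) + 2) * ((m + 1) * m) := by
  have h := Nat.add_one_mul_choose_eq (m + 1) 2
  have h2 := u1_two_choose m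
  have h' : (((m + 1 + 1) * (m + 1).choose 2 : ℕ) : ℤ)
      = (((m + 1 + 1).choose (2 + 1) * (2 + 1) : ℕ) : ℤ) := by rw [h]
  push_cast at h'
  have e : m + 1 + 1 = m + 2 := rfl
  rw [e] at h'
  linear_combination (-2) * h' + (m + 2 : ℤ) * h2

theorem u1_six_terms (M : ℕ) (f : ℕ → ℤ) (h : ∀ i < M, f (i + 3) = 0) :
    ∑ l ∈ Finset.range (M + 6), f l
      = f 0 + f 1 + f 2 + f (M + 3) + f (M + 4) + f (M + 5) := by
  have e : ∑ l ∈ Finset.range M, f (l + 3) = 0 :=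
    Finset.sum_eq_zero (fun i hi => h i (Finset.mem_range.mp hi))
  rw [Finset.sum_range_succ, Finset.sum_range_succ, Finset.sum_range_succ,
    Finset.sum_range_succ', Finset.sum_range_succ', Finset.sum_range_succ']
  simp only [zero_add, add_assoc, Nat.reduceAdd] at *
  rw [e]
  ring

theorem u1_shift (N j : ℕ) (x : ℕ → ℤ) :
    ∑ l ∈ Finset.Icc j (N + j), (N.choose (l - j) : ℤ) * x l
      = ∑ i ∈ Finset.range (N + 1), (N.choose i : ℤ) * x (i + j) := by
  symm
  apply Finset.sum_bij (fun i _ => i + j)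
  · intro a ha
    simp only [Finset.mem_range] at ha
    simp only [Finset.mem_Icc]
    omega
  · intro a _ b _ hab
    simpa using hab
  · intro b hb
    simp only [Finset.mem_Icc] at hb
    exact ⟨b - j, by simp only [Finset.mem_range]; omega, by omega⟩
  · intro a _
    simp

theorem u1_choose_lower (n k : ℕ) (h3 : 3 ≤ k) (hk : k ≤ n / 2) : n.choose 3 ≤ n.choose k := by
  induction k, h3 using Nat.le_induction with
  | base => exact le_rfl
  | succ k hk3 ih =>
    exact (ih (by omega)).trans (Nat.choose_le_succ_of_lt_half_left (by omega))

theorem u1_choose_lower' (n k : ℕ) (h3 : 3 ≤ k) (hk : k + 3 ≤ n) : n.choose 3 ≤ n.choose k := by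
  by_cases h : k ≤ n / 2
  · exact u1_choose_lower n k h3 h
  · rw [← Nat.choose_symm (show k ≤ n by omega)]
    exact u1_choose_lower n (n - k) (by omega) (by omega)

/-- existence -/
theorem u1_exists (n t : ℕ) (hn : 4 ≤ n) (ht : (n : ℤ) * ((n : ℤ) - 2) ≤ t) :
    ∃ x : ℕ → ℤ, U1Nontrivial n x ∧ U1System n 3 t x := by
  obtain rfl | hn5 := hn.eq_or_lt
  · refine ⟨fun l => (-1) ^ l, ⟨0, by simp, by simp⟩, ?_, ?_⟩
    · norm_num [Finset.sum_range_succ, Nat.choose] at ht ⊢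
      omega
    · decide
  obtain ⟨m, rfl⟩ : ∃ m, n = m + 5 := ⟨n - 5, by omega⟩
  have c1 := u1_two_choose (m + 4)
  have c2 := u1_two_choose (m + 2)
  have c3 := u1_two_choose (m + 1)
  simp only [add_assoc, Nat.reduceAdd] at c1 c2 c3
  push_cast at c1 c2 c3 ht
  set A : ℤ := (((m + 3).choose 2 : ℕ) : ℤ) with hA
  have s1 : (m + 5).choose (m + 4) = m + 5 := Nat.choose_succ_self_right (m + 4)
  have s2 : (m + 2).choose (m + 1) = m + 2 := Nat.choose_succ_self_right (m + 1)
  refine ⟨fun l => if l = 0 then A else if l = 1 then -((m : ℤ) + 2) else if l = 2 then 1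
    else if l = m + 4 then -1 else if l = m + 5 then (m : ℤ) + 2 else 0, ?_, ?_, ?_⟩
  · exact ⟨2, by simp, by simp⟩
  · have hx : ∀ l : ℕ, (((m + 5).choose l : ℕ) : ℤ) * |(if l = 0 then A else if l = 1 then -((m : ℤ) + 2)
        else if l = 2 then 1
        else if l = m + 4 then -1 else if l = m + 5 then (m : ℤ) + 2 else 0)|
        = (if l = 0 then A else 0) + (if l = 1 then ((m : ℤ) + 5) * (m + 2) else 0)
          + (if l = 2 then (((m + 5).choose 2 : ℕ) : ℤ) else 0)
          + (if l = m + 4 then (m : ℤ) + 5 else 0) + (if l = m + 5 then (m : ℤ) + 2 else 0) := by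
      intro l
      have p2 : |(m : ℤ) + 2| = m + 2 := abs_of_nonneg (by positivity)
      have pA : |A| = A := abs_of_nonneg (by positivity)
      by_cases h0 : l = 0
      · subst h0; simp [pA]
      by_cases h1 : l = 1
      · subst h1; simp [abs_neg, p2, -neg_add_rev]
      by_cases h2 : l = 2
      · subst h2; simp
      by_cases h3 : l = m + 4
      · subst h3; simp only [s1]; simp
      by_cases h4 : l = m + 5
      · subst h4; simp [p2]
      simp [h0, h1, h2, h3, h4]
    rw [Finset.sum_congr rfl (fun l _ => hx l)]
    simp only [Finset.sum_add_distrib, Finset.sum_ite_eq', Finset.mem_range]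
    rw [if_pos (by omega), if_pos (by omega), if_pos (by omega), if_pos (by omega),
      if_pos (by omega)]
    nlinarith
  · intro j hj
    have hj : j < 4 := by simpa using hj
    have hx : ∀ l : ℕ, (((m + 5 - 3).choose (l - j) : ℕ) : ℤ) * (if l = 0 then A else if l = 1 then -((m : ℤ) + 2)
        else if l = 2 then 1
        else if l = m + 4 then -1 else if l = m + 5 then (m : ℤ) + 2 else 0)
        = (if l = 0 then (((m + 2).choose (0 - j) : ℕ) : ℤ) * A else 0)
          + (if l = 1 then (((m + 2).choose (1 - j) : ℕ) : ℤ) * (-((m : ℤ) + 2)) else 0)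
          + (if l = 2 then (((m + 2).choose (2 - j) : ℕ) : ℤ) else 0)
          + (if l = m + 4 then -(((m + 2).choose (m + 4 - j) : ℕ) : ℤ) else 0)
          + (if l = m + 5 then (((m + 2).choose (m + 5 - j) : ℕ) : ℤ) * ((m : ℤ) + 2) else 0) := by
      intro l
      have e : m + 5 - 3 = m + 2 := by omega
      rw [e]
      by_cases h0 : l = 0
      · subst h0; simp
      by_cases h1 : l = 1
      · subst h1; simp
      by_cases h2 : l = 2
      · subst h2; simp
      by_cases h3 : l = m + 4
      · subst h3; simp
      by_cases h4 : l = m + 5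
      · subst h4; simp
      simp [h0, h1, h2, h3, h4]
    rw [Finset.sum_congr rfl (fun l _ => hx l)]
    simp only [Finset.sum_add_distrib, Finset.sum_ite_eq', Finset.mem_Icc]
    interval_cases j
    · rw [if_pos (by omega), if_pos (by omega), if_pos (by omega), if_neg (by omega),
        if_neg (by omega)]
      simp
      nlinarith
    · rw [if_neg (by omega), if_pos (by omega), if_pos (by omega), if_neg (by omega),
        if_neg (by omega)]
      simp
    · rw [if_neg (by omega), if_neg (by omega), if_pos (by omega), if_pos (by omega),
        if_neg (by omega)]
      simp
    · rw [if_neg (by omega), if_neg (by omega), if_neg (by omega), if_pos (by omega),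
        if_pos (by omega)]
      have e1 : m + 4 - 3 = m + 1 := by omega
      have e2 : m + 5 - 3 = m + 2 := by omega
      rw [e1, e2, s2]
      simp

set_option maxHeartbeats 2000000 in
theorem u1_big (n : ℕ) (hn : 13 ≤ n) (x : ℕ → ℤ) (hx : U1Nontrivial n x)
    (t : ℕ) (h : U1System n 3 t x) : (n : ℤ) * ((n : ℤ) - 2) ≤ t := by
  by_contra hlt
  push Not at hlt
  obtain ⟨hA, hB⟩ := h
  obtain ⟨m, rfl⟩ : ∃ m, n = m + 13 := ⟨n - 13, by omega⟩
  have hz : ∀ l, 3 ≤ l → l ≤ m + 10 → x l = 0 := by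
    intro l h3 hl
    by_contra hne
    have h1 : (((m + 13).choose l : ℕ) : ℤ) * |x l| ≤ 2 * (t : ℤ) :=
      (Finset.single_le_sum (f := fun l => (((m + 13).choose l : ℕ) : ℤ) * |x l|)
        (fun i _ => by positivity) (Finset.mem_range.mpr (by omega))).trans hA
    have h2 : (((m + 13).choose 3 : ℕ) : ℤ) ≤ (((m + 13).choose l : ℕ) : ℤ) := by
      exact_mod_cast u1_choose_lower' (m + 13) l h3 (by omega)
    have h3 := u1_six_choose (m + 11)
    simp only [add_assoc, Nat.reduceAdd] at h3
    have h4 : 1 ≤ |x l| := Int.one_le_abs hne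
    push_cast at h3 hlt
    nlinarith
  have key : ∀ j < 4, x j + (m + 10 : ℤ) * x (1 + j) + (((m + 10).choose 2 : ℕ) : ℤ) * x (2 + j)
      + (((m + 10).choose 2 : ℕ) : ℤ) * x (m + 8 + j) + (m + 10 : ℤ) * x (m + 9 + j)
      + x (m + 10 + j) = 0 := by
    intro j hj
    have := hB j (by simpa using hj)
    have e : m + 13 - 3 = m + 10 := by omega
    rw [e, u1_shift] at this
    have e2 : m + 10 + 1 = (m + 5) + 6 := by omega
    rw [e2, u1_six_terms (m + 5) _ (fun i hi => by
      rw [hz (i + 3 + j) (by omega) (by omega), mul_zero])] at this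
    have s1 : (m + 10).choose (m + 8) = (m + 10).choose 2 := by
      rw [← Nat.choose_symm (show 2 ≤ m + 10 by omega)]; rfl
    have s2 : (m + 10).choose (m + 9) = m + 10 := Nat.choose_succ_self_right (m + 9)
    simp only [add_assoc, Nat.reduceAdd] at this
    rw [s1, s2] at this
    simp at this
    simp only [add_assoc] at *
    linarith
  have k0 := key 0 (by norm_num)
  have k1 := key 1 (by norm_num)
  have k2 := key 2 (by norm_num)
  have k3 := key 3 (by norm_num)
  simp only [add_assoc, Nat.reduceAdd, add_zero] at k0 k1 k2 k3
  simp only [hz 3 (by omega) (by omega), hz 4 (by omega) (by omega), hz 5 (by omega) (by omega),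
    hz (m + 8) (by omega) (by omega), hz (m + 9) (by omega) (by omega),
    hz (m + 10) (by omega) (by omega)] at k0 k1 k2 k3
  have e6 : m + 13 + 1 = (m + 8) + 6 := by omega
  rw [e6, u1_six_terms (m + 8) _ (fun i hi => by
      rw [hz (i + 3) (by omega) (by omega), abs_zero, mul_zero])] at hA
  have s1 : (m + 13).choose (m + 11) = (m + 13).choose 2 := by
    rw [← Nat.choose_symm (show 2 ≤ m + 13 by omega)]; rfl
  have s2 : (m + 13).choose (m + 12) = m + 13 := Nat.choose_succ_self_right (m + 12)
  simp only [add_assoc, Nat.reduceAdd] at hA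
  rw [s1, s2] at hA
  simp only [Nat.choose_zero_right, Nat.choose_one_right, Nat.choose_self] at hA
  have c1 := u1_two_choose (m + 12)
  have c2 := u1_two_choose (m + 9)
  simp only [add_assoc, Nat.reduceAdd] at c1 c2
  push_cast at hA hlt c1 c2
  have hne : x 2 ≠ 0 ∨ x (m + 11) ≠ 0 := by
    by_contra hc
    push Not at hc
    obtain ⟨ha, hb⟩ := hc
    rw [ha, hb] at k1 k2
    rw [ha] at k0
    rw [hb] at k3
    have x1 : x 1 = 0 := by linarith
    have x12 : x (m + 12) = 0 := by linarith
    rw [x1] at k0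
    rw [x12] at k3
    have x0 : x 0 = 0 := by linarith
    have x13 : x (m + 13) = 0 := by linarith
    obtain ⟨l, hl, hl0⟩ := hx
    have hl : l < m + 13 + 1 := by simpa using hl
    apply hl0
    rcases (show l = 0 ∨ l = 1 ∨ l = 2 ∨ (3 ≤ l ∧ l ≤ m + 10) ∨ l = m + 11 ∨ l = m + 12 ∨ l = m + 13
      by omega) with h | h | h | h | h | h | h
    · rw [h, x0]
    · rw [h, x1]
    · rw [h, ha]
    · exact hz l h.1 h.2
    · rw [h, hb]
    · rw [h, x12]
    · rw [h, x13]
  have y1 : x 1 = -((m + 10) * x 2 + x (m + 11)) := by linarith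
  have y12 : x (m + 12) = -(x 2 + (m + 10) * x (m + 11)) := by linarith
  have y0 : 2 * x 0 = (m + 11) * (m + 10) * x 2 + 2 * (m + 10) * x (m + 11) := by
    rw [y1] at k0
    linear_combination 2 * k0 - c2 * x 2
  have y13 : 2 * x (m + 13) = (m + 11) * (m + 10) * x (m + 11) + 2 * (m + 10) * x 2 := by
    rw [y12] at k3
    linear_combination 2 * k3 - c2 * x (m + 11)
  generalize x 0 = a0 at *
  generalize x 1 = a1 at *
  generalize x 2 = a at *
  generalize x (m + 11) = b at *
  generalize x (m + 12) = b1 at *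
  generalize x (m + 13) = b0 at *
  generalize (((m + 13).choose 2 : ℕ) : ℤ) = C at *
  have hm : (0 : ℤ) ≤ m := by positivity
  generalize (m : ℤ) = M at *
  have hC : 2 * (C * |a| + C * |b|) = (M + 13) * (M + 12) * (|a| + |b|) := by
    linear_combination c1 * (|a| + |b|)
  by_cases hb : b = 0
  · subst hb
    have ha : 1 ≤ |a| := Int.one_le_abs (by tauto)
    have z1 : |a1| = (M + 10) * |a| := by
      rw [y1, add_zero, abs_neg, abs_mul, abs_of_nonneg (by linarith)]
    have z12 : |b1| = |a| := by rw [y12]; simp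
    have z0 : 2 * |a0| = (M + 11) * (M + 10) * |a| := by
      have := congrArg abs y0
      simp only [mul_zero, add_zero, abs_mul] at this
      rwa [abs_two, abs_of_nonneg (show 0 ≤ M + 11 by linarith),
        abs_of_nonneg (show 0 ≤ M + 10 by linarith)] at this
    have z13 : |b0| = (M + 10) * |a| := by
      have : b0 = (M + 10) * a := by linarith
      rw [this, abs_mul, abs_of_nonneg (by linarith)]
    rw [z1, z12, z13] at hA
    simp only [abs_zero, mul_zero, add_zero] at *
    nlinarith
  by_cases ha : a = 0
  · subst ha
    have hb : 1 ≤ |b| := Int.one_le_abs hb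
    have z1 : |b1| = (M + 10) * |b| := by
      rw [y12, zero_add, abs_neg, abs_mul, abs_of_nonneg (by linarith)]
    have z12 : |a1| = |b| := by rw [y1]; simp
    have z0 : 2 * |b0| = (M + 11) * (M + 10) * |b| := by
      have := congrArg abs y13
      simp only [mul_zero, add_zero, abs_mul] at this
      rwa [abs_two, abs_of_nonneg (show 0 ≤ M + 11 by linarith),
        abs_of_nonneg (show 0 ≤ M + 10 by linarith)] at this
    have z13 : |a0| = (M + 10) * |b| := by
      have : a0 = (M + 10) * b := by linarith
      rw [this, abs_mul, abs_of_nonneg (by linarith)]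
    rw [z1, z12, z13] at hA
    simp only [abs_zero, mul_zero, zero_add] at *
    nlinarith
  have ha1 : 1 ≤ |a| := Int.one_le_abs ha
  have hb1 : 1 ≤ |b| := Int.one_le_abs hb
  have w : (M + 9) * (|a| + |b|) ≤ |a1| + |b1| := by
    have t1 : (M + 10) * |a| ≤ |a1| + |b| := by
      have : (M + 10) * a = -a1 - b := by linarith
      calc (M + 10) * |a| = |(M + 10) * a| := by
            rw [abs_mul, abs_of_nonneg (show 0 ≤ M + 10 by linarith)]
        _ = |-a1 - b| := by rw [this]
        _ ≤ |-a1| + |b| := abs_sub _ _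
        _ = _ := by rw [abs_neg]
    have t2 : (M + 10) * |b| ≤ |b1| + |a| := by
      have : (M + 10) * b = -b1 - a := by linarith
      calc (M + 10) * |b| = |(M + 10) * b| := by
            rw [abs_mul, abs_of_nonneg (show 0 ≤ M + 10 by linarith)]
        _ = |-b1 - a| := by rw [this]
        _ ≤ |-b1| + |a| := abs_sub _ _
        _ = _ := by rw [abs_neg]
    linarith
  have p0 := abs_nonneg a0
  have p13 := abs_nonneg b0
  have w2 : (M + 9) * 2 ≤ |a1| + |b1| := by nlinarith
  have w3 : (M + 13) * ((M + 9) * 2) ≤ (M + 13) * (|a1| + |b1|) :=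
    mul_le_mul_of_nonneg_left w2 (by linarith)
  have w4 : (M + 13) * (M + 12) * 2 ≤ (M + 13) * (M + 12) * (|a| + |b|) :=
    mul_le_mul_of_nonneg_left (by linarith) (by positivity)
  nlinarith

set_option linter.unusedTactic false
set_option linter.unnecessarySeqFocus false

theorem u1_abs (y : ℤ) : y ≤ |y| ∧ -y ≤ |y| := ⟨le_abs_self y, neg_le_abs y⟩

theorem u1_core_4 {x0 x1 x2 x3 x4 a0 a1 a2 a3 a4 : ℤ}
    (p0 : x0 ≤ a0 ∧ -x0 ≤ a0)
    (p1 : x1 ≤ a1 ∧ -x1 ≤ a1)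
    (p2 : x2 ≤ a2 ∧ -x2 ≤ a2)
    (p3 : x3 ≤ a3 ∧ -x3 ≤ a3)
    (p4 : x4 ≤ a4 ∧ -x4 ≤ a4)
    (hA : a0 + 4 * a1 + 6 * a2 + 4 * a3 + a4 < 16)
    (k0 : x0 + x1 = 0)
    (k1 : x1 + x2 = 0)
    (k2 : x2 + x3 = 0)
    (k3 : x3 + x4 = 0)
    : x0 = 0 ∧ x1 = 0 ∧ x2 = 0 ∧ x3 = 0 ∧ x4 = 0 := by
  cases p0; cases p1; cases p2; cases p3; cases p4
  obtain ⟨l2, u2⟩ : -2 ≤ x2 ∧ x2 ≤ 2 := by omega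
  interval_cases x2 <;> try (exfalso; clear k0 k1 k2 k3; linarith)
  all_goals omega

theorem u1_core_5 {x0 x1 x2 x3 x4 x5 a0 a1 a2 a3 a4 a5 : ℤ}
    (p0 : x0 ≤ a0 ∧ -x0 ≤ a0)
    (p1 : x1 ≤ a1 ∧ -x1 ≤ a1)
    (p2 : x2 ≤ a2 ∧ -x2 ≤ a2)
    (p3 : x3 ≤ a3 ∧ -x3 ≤ a3)
    (p4 : x4 ≤ a4 ∧ -x4 ≤ a4)
    (p5 : x5 ≤ a5 ∧ -x5 ≤ a5)
    (hA : a0 + 5 * a1 + 10 * a2 + 10 * a3 + 5 * a4 + a5 < 30)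
    (k0 : x0 + 2 * x1 + x2 = 0)
    (k1 : x1 + 2 * x2 + x3 = 0)
    (k2 : x2 + 2 * x3 + x4 = 0)
    (k3 : x3 + 2 * x4 + x5 = 0)
    : x0 = 0 ∧ x1 = 0 ∧ x2 = 0 ∧ x3 = 0 ∧ x4 = 0 ∧ x5 = 0 := by
  cases p0; cases p1; cases p2; cases p3; cases p4; cases p5
  obtain ⟨⟨l2, u2⟩, ⟨l3, u3⟩⟩ : (-2 ≤ x2 ∧ x2 ≤ 2) ∧ (-2 ≤ x3 ∧ x3 ≤ 2) := by
    clear k0 k1 k2 k3; refine ⟨?_, ?_⟩ <;> omega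
  interval_cases x2 <;> try (exfalso; clear k0 k1 k2 k3; linarith)
  all_goals interval_cases x3 <;> try (exfalso; clear k0 k1 k2 k3; linarith)
  all_goals omega

theorem u1_core_6 {x0 x1 x2 x3 x4 x5 x6 a0 a1 a2 a3 a4 a5 a6 : ℤ}
    (p0 : x0 ≤ a0 ∧ -x0 ≤ a0)
    (p1 : x1 ≤ a1 ∧ -x1 ≤ a1)
    (p2 : x2 ≤ a2 ∧ -x2 ≤ a2)
    (p3 : x3 ≤ a3 ∧ -x3 ≤ a3)
    (p4 : x4 ≤ a4 ∧ -x4 ≤ a4)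
    (p5 : x5 ≤ a5 ∧ -x5 ≤ a5)
    (p6 : x6 ≤ a6 ∧ -x6 ≤ a6)
    (hA : a0 + 6 * a1 + 15 * a2 + 20 * a3 + 15 * a4 + 6 * a5 + a6 < 48)
    (k0 : x0 + 3 * x1 + 3 * x2 + x3 = 0)
    (k1 : x1 + 3 * x2 + 3 * x3 + x4 = 0)
    (k2 : x2 + 3 * x3 + 3 * x4 + x5 = 0)
    (k3 : x3 + 3 * x4 + 3 * x5 + x6 = 0)
    : x0 = 0 ∧ x1 = 0 ∧ x2 = 0 ∧ x3 = 0 ∧ x4 = 0 ∧ x5 = 0 ∧ x6 = 0 := by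
  cases p0; cases p1; cases p2; cases p3; cases p4; cases p5; cases p6
  obtain ⟨⟨l3, u3⟩, ⟨l2, u2⟩, ⟨l4, u4⟩⟩ : (-2 ≤ x3 ∧ x3 ≤ 2) ∧ (-3 ≤ x2 ∧ x2 ≤ 3) ∧ (-3 ≤ x4 ∧ x4 ≤ 3) := by
    clear k0 k1 k2 k3; refine ⟨?_, ?_, ?_⟩ <;> omega
  interval_cases x3 <;> try (exfalso; clear k0 k1 k2 k3; linarith)
  all_goals interval_cases x2 <;> try (exfalso; clear k0 k1 k2 k3; linarith)
  all_goals interval_cases x4 <;> try (exfalso; clear k0 k1 k2 k3; linarith)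
  all_goals omega

theorem u1_core_7 {x0 x1 x2 x3 x4 x5 x6 x7 a0 a1 a2 a3 a4 a5 a6 a7 : ℤ}
    (p0 : x0 ≤ a0 ∧ -x0 ≤ a0)
    (p1 : x1 ≤ a1 ∧ -x1 ≤ a1)
    (p2 : x2 ≤ a2 ∧ -x2 ≤ a2)
    (p3 : x3 ≤ a3 ∧ -x3 ≤ a3)
    (p4 : x4 ≤ a4 ∧ -x4 ≤ a4)
    (p5 : x5 ≤ a5 ∧ -x5 ≤ a5)
    (p6 : x6 ≤ a6 ∧ -x6 ≤ a6)
    (p7 : x7 ≤ a7 ∧ -x7 ≤ a7)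
    (hA : a0 + 7 * a1 + 21 * a2 + 35 * a3 + 35 * a4 + 21 * a5 + 7 * a6 + a7 < 70)
    (k0 : x0 + 4 * x1 + 6 * x2 + 4 * x3 + x4 = 0)
    (k1 : x1 + 4 * x2 + 6 * x3 + 4 * x4 + x5 = 0)
    (k2 : x2 + 4 * x3 + 6 * x4 + 4 * x5 + x6 = 0)
    (k3 : x3 + 4 * x4 + 6 * x5 + 4 * x6 + x7 = 0)
    : x0 = 0 ∧ x1 = 0 ∧ x2 = 0 ∧ x3 = 0 ∧ x4 = 0 ∧ x5 = 0 ∧ x6 = 0 ∧ x7 = 0 := by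
  cases p0; cases p1; cases p2; cases p3; cases p4; cases p5; cases p6; cases p7
  obtain ⟨⟨l3, u3⟩, ⟨l4, u4⟩, ⟨l2, u2⟩, ⟨l5, u5⟩⟩ : (-1 ≤ x3 ∧ x3 ≤ 1) ∧ (-1 ≤ x4 ∧ x4 ≤ 1) ∧ (-3 ≤ x2 ∧ x2 ≤ 3) ∧ (-3 ≤ x5 ∧ x5 ≤ 3) := by
    clear k0 k1 k2 k3; refine ⟨?_, ?_, ?_, ?_⟩ <;> omega
  interval_cases x3 <;> try (exfalso; clear k0 k1 k2 k3; linarith)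
  all_goals interval_cases x4 <;> try (exfalso; clear k0 k1 k2 k3; linarith)
  all_goals interval_cases x2 <;> try (exfalso; clear k0 k1 k2 k3; linarith)
  all_goals interval_cases x5 <;> try (exfalso; clear k0 k1 k2 k3; linarith)
  all_goals omega

theorem u1_core_8 {x0 x1 x2 x3 x4 x5 x6 x7 x8 a0 a1 a2 a3 a4 a5 a6 a7 a8 : ℤ}
    (p0 : x0 ≤ a0 ∧ -x0 ≤ a0)
    (p1 : x1 ≤ a1 ∧ -x1 ≤ a1)
    (p2 : x2 ≤ a2 ∧ -x2 ≤ a2)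
    (p3 : x3 ≤ a3 ∧ -x3 ≤ a3)
    (p4 : x4 ≤ a4 ∧ -x4 ≤ a4)
    (p5 : x5 ≤ a5 ∧ -x5 ≤ a5)
    (p6 : x6 ≤ a6 ∧ -x6 ≤ a6)
    (p7 : x7 ≤ a7 ∧ -x7 ≤ a7)
    (p8 : x8 ≤ a8 ∧ -x8 ≤ a8)
    (hA : a0 + 8 * a1 + 28 * a2 + 56 * a3 + 70 * a4 + 56 * a5 + 28 * a6 + 8 * a7 + a8 < 96)
    (k0 : x0 + 5 * x1 + 10 * x2 + 10 * x3 + 5 * x4 + x5 = 0)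
    (k1 : x1 + 5 * x2 + 10 * x3 + 10 * x4 + 5 * x5 + x6 = 0)
    (k2 : x2 + 5 * x3 + 10 * x4 + 10 * x5 + 5 * x6 + x7 = 0)
    (k3 : x3 + 5 * x4 + 10 * x5 + 10 * x6 + 5 * x7 + x8 = 0)
    : x0 = 0 ∧ x1 = 0 ∧ x2 = 0 ∧ x3 = 0 ∧ x4 = 0 ∧ x5 = 0 ∧ x6 = 0 ∧ x7 = 0 ∧ x8 = 0 := by
  cases p0; cases p1; cases p2; cases p3; cases p4; cases p5; cases p6; cases p7; cases p8
  obtain ⟨⟨l4, u4⟩, ⟨l3, u3⟩, ⟨l5, u5⟩, ⟨l2, u2⟩, ⟨l6, u6⟩⟩ : (-1 ≤ x4 ∧ x4 ≤ 1) ∧ (-1 ≤ x3 ∧ x3 ≤ 1) ∧ (-1 ≤ x5 ∧ x5 ≤ 1) ∧ (-3 ≤ x2 ∧ x2 ≤ 3) ∧ (-3 ≤ x6 ∧ x6 ≤ 3) := by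
    clear k0 k1 k2 k3; refine ⟨?_, ?_, ?_, ?_, ?_⟩ <;> omega
  interval_cases x4 <;> try (exfalso; clear k0 k1 k2 k3; linarith)
  all_goals interval_cases x3 <;> try (exfalso; clear k0 k1 k2 k3; linarith)
  all_goals interval_cases x5 <;> try (exfalso; clear k0 k1 k2 k3; linarith)
  all_goals interval_cases x2 <;> try (exfalso; clear k0 k1 k2 k3; linarith)
  all_goals interval_cases x6 <;> try (exfalso; clear k0 k1 k2 k3; linarith)
  all_goals omega

theorem u1_core_9 {x0 x1 x2 x3 x4 x5 x6 x7 x8 x9 a0 a1 a2 a3 a4 a5 a6 a7 a8 a9 : ℤ}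
    (p0 : x0 ≤ a0 ∧ -x0 ≤ a0)
    (p1 : x1 ≤ a1 ∧ -x1 ≤ a1)
    (p2 : x2 ≤ a2 ∧ -x2 ≤ a2)
    (p3 : x3 ≤ a3 ∧ -x3 ≤ a3)
    (p4 : x4 ≤ a4 ∧ -x4 ≤ a4)
    (p5 : x5 ≤ a5 ∧ -x5 ≤ a5)
    (p6 : x6 ≤ a6 ∧ -x6 ≤ a6)
    (p7 : x7 ≤ a7 ∧ -x7 ≤ a7)
    (p8 : x8 ≤ a8 ∧ -x8 ≤ a8)
    (p9 : x9 ≤ a9 ∧ -x9 ≤ a9)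
    (hA : a0 + 9 * a1 + 36 * a2 + 84 * a3 + 126 * a4 + 126 * a5 + 84 * a6 + 36 * a7 + 9 * a8 + a9 < 126)
    (k0 : x0 + 6 * x1 + 15 * x2 + 20 * x3 + 15 * x4 + 6 * x5 + x6 = 0)
    (k1 : x1 + 6 * x2 + 15 * x3 + 20 * x4 + 15 * x5 + 6 * x6 + x7 = 0)
    (k2 : x2 + 6 * x3 + 15 * x4 + 20 * x5 + 15 * x6 + 6 * x7 + x8 = 0)
    (k3 : x3 + 6 * x4 + 15 * x5 + 20 * x6 + 15 * x7 + 6 * x8 + x9 = 0)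
    : x0 = 0 ∧ x1 = 0 ∧ x2 = 0 ∧ x3 = 0 ∧ x4 = 0 ∧ x5 = 0 ∧ x6 = 0 ∧ x7 = 0 ∧ x8 = 0 ∧ x9 = 0 := by
  cases p0; cases p1; cases p2; cases p3; cases p4; cases p5; cases p6; cases p7; cases p8; cases p9
  obtain ⟨⟨l4, u4⟩, ⟨l5, u5⟩, ⟨l3, u3⟩, ⟨l6, u6⟩, ⟨l2, u2⟩, ⟨l7, u7⟩⟩ : (0 ≤ x4 ∧ x4 ≤ 0) ∧ (0 ≤ x5 ∧ x5 ≤ 0) ∧ (-1 ≤ x3 ∧ x3 ≤ 1) ∧ (-1 ≤ x6 ∧ x6 ≤ 1) ∧ (-3 ≤ x2 ∧ x2 ≤ 3) ∧ (-3 ≤ x7 ∧ x7 ≤ 3) := by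
    clear k0 k1 k2 k3; refine ⟨?_, ?_, ?_, ?_, ?_, ?_⟩ <;> omega
  interval_cases x4 <;> try (exfalso; clear k0 k1 k2 k3; linarith)
  all_goals interval_cases x5 <;> try (exfalso; clear k0 k1 k2 k3; linarith)
  all_goals interval_cases x3 <;> try (exfalso; clear k0 k1 k2 k3; linarith)
  all_goals interval_cases x6 <;> try (exfalso; clear k0 k1 k2 k3; linarith)
  all_goals interval_cases x2 <;> try (exfalso; clear k0 k1 k2 k3; linarith)
  all_goals interval_cases x7 <;> try (exfalso; clear k0 k1 k2 k3; linarith)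
  all_goals omega

theorem u1_core_10 {x0 x1 x2 x3 x4 x5 x6 x7 x8 x9 x10 a0 a1 a2 a3 a4 a5 a6 a7 a8 a9 a10 : ℤ}
    (p0 : x0 ≤ a0 ∧ -x0 ≤ a0)
    (p1 : x1 ≤ a1 ∧ -x1 ≤ a1)
    (p2 : x2 ≤ a2 ∧ -x2 ≤ a2)
    (p3 : x3 ≤ a3 ∧ -x3 ≤ a3)
    (p4 : x4 ≤ a4 ∧ -x4 ≤ a4)
    (p5 : x5 ≤ a5 ∧ -x5 ≤ a5)
    (p6 : x6 ≤ a6 ∧ -x6 ≤ a6)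
    (p7 : x7 ≤ a7 ∧ -x7 ≤ a7)
    (p8 : x8 ≤ a8 ∧ -x8 ≤ a8)
    (p9 : x9 ≤ a9 ∧ -x9 ≤ a9)
    (p10 : x10 ≤ a10 ∧ -x10 ≤ a10)
    (hA : a0 + 10 * a1 + 45 * a2 + 120 * a3 + 210 * a4 + 252 * a5 + 210 * a6 + 120 * a7 + 45 * a8 + 10 * a9 + a10 < 160)
    (k0 : x0 + 7 * x1 + 21 * x2 + 35 * x3 + 35 * x4 + 21 * x5 + 7 * x6 + x7 = 0)
    (k1 : x1 + 7 * x2 + 21 * x3 + 35 * x4 + 35 * x5 + 21 * x6 + 7 * x7 + x8 = 0)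
    (k2 : x2 + 7 * x3 + 21 * x4 + 35 * x5 + 35 * x6 + 21 * x7 + 7 * x8 + x9 = 0)
    (k3 : x3 + 7 * x4 + 21 * x5 + 35 * x6 + 35 * x7 + 21 * x8 + 7 * x9 + x10 = 0)
    : x0 = 0 ∧ x1 = 0 ∧ x2 = 0 ∧ x3 = 0 ∧ x4 = 0 ∧ x5 = 0 ∧ x6 = 0 ∧ x7 = 0 ∧ x8 = 0 ∧ x9 = 0 ∧ x10 = 0 := by
  cases p0; cases p1; cases p2; cases p3; cases p4; cases p5; cases p6; cases p7; cases p8; cases p9; cases p10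
  obtain ⟨⟨l5, u5⟩, ⟨l4, u4⟩, ⟨l6, u6⟩, ⟨l3, u3⟩, ⟨l7, u7⟩, ⟨l2, u2⟩, ⟨l8, u8⟩⟩ : (0 ≤ x5 ∧ x5 ≤ 0) ∧ (0 ≤ x4 ∧ x4 ≤ 0) ∧ (0 ≤ x6 ∧ x6 ≤ 0) ∧ (-1 ≤ x3 ∧ x3 ≤ 1) ∧ (-1 ≤ x7 ∧ x7 ≤ 1) ∧ (-3 ≤ x2 ∧ x2 ≤ 3) ∧ (-3 ≤ x8 ∧ x8 ≤ 3) := by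
    clear k0 k1 k2 k3; refine ⟨?_, ?_, ?_, ?_, ?_, ?_, ?_⟩ <;> omega
  interval_cases x5 <;> try (exfalso; clear k0 k1 k2 k3; linarith)
  all_goals interval_cases x4 <;> try (exfalso; clear k0 k1 k2 k3; linarith)
  all_goals interval_cases x6 <;> try (exfalso; clear k0 k1 k2 k3; linarith)
  all_goals interval_cases x3 <;> try (exfalso; clear k0 k1 k2 k3; linarith)
  all_goals interval_cases x7 <;> try (exfalso; clear k0 k1 k2 k3; linarith)
  all_goals interval_cases x2 <;> try (exfalso; clear k0 k1 k2 k3; linarith)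
  all_goals interval_cases x8 <;> try (exfalso; clear k0 k1 k2 k3; linarith)
  all_goals omega

theorem u1_core_11 {x0 x1 x2 x3 x4 x5 x6 x7 x8 x9 x10 x11 a0 a1 a2 a3 a4 a5 a6 a7 a8 a9 a10 a11 : ℤ}
    (p0 : x0 ≤ a0 ∧ -x0 ≤ a0)
    (p1 : x1 ≤ a1 ∧ -x1 ≤ a1)
    (p2 : x2 ≤ a2 ∧ -x2 ≤ a2)
    (p3 : x3 ≤ a3 ∧ -x3 ≤ a3)
    (p4 : x4 ≤ a4 ∧ -x4 ≤ a4)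
    (p5 : x5 ≤ a5 ∧ -x5 ≤ a5)
    (p6 : x6 ≤ a6 ∧ -x6 ≤ a6)
    (p7 : x7 ≤ a7 ∧ -x7 ≤ a7)
    (p8 : x8 ≤ a8 ∧ -x8 ≤ a8)
    (p9 : x9 ≤ a9 ∧ -x9 ≤ a9)
    (p10 : x10 ≤ a10 ∧ -x10 ≤ a10)
    (p11 : x11 ≤ a11 ∧ -x11 ≤ a11)
    (hA : a0 + 11 * a1 + 55 * a2 + 165 * a3 + 330 * a4 + 462 * a5 + 462 * a6 + 330 * a7 + 165 * a8 + 55 * a9 + 11 * a10 + a11 < 198)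
    (k0 : x0 + 8 * x1 + 28 * x2 + 56 * x3 + 70 * x4 + 56 * x5 + 28 * x6 + 8 * x7 + x8 = 0)
    (k1 : x1 + 8 * x2 + 28 * x3 + 56 * x4 + 70 * x5 + 56 * x6 + 28 * x7 + 8 * x8 + x9 = 0)
    (k2 : x2 + 8 * x3 + 28 * x4 + 56 * x5 + 70 * x6 + 56 * x7 + 28 * x8 + 8 * x9 + x10 = 0)
    (k3 : x3 + 8 * x4 + 28 * x5 + 56 * x6 + 70 * x7 + 56 * x8 + 28 * x9 + 8 * x10 + x11 = 0)
    : x0 = 0 ∧ x1 = 0 ∧ x2 = 0 ∧ x3 = 0 ∧ x4 = 0 ∧ x5 = 0 ∧ x6 = 0 ∧ x7 = 0 ∧ x8 = 0 ∧ x9 = 0 ∧ x10 = 0 ∧ x11 = 0 := by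
  cases p0; cases p1; cases p2; cases p3; cases p4; cases p5; cases p6; cases p7; cases p8; cases p9; cases p10; cases p11
  obtain ⟨⟨l5, u5⟩, ⟨l6, u6⟩, ⟨l4, u4⟩, ⟨l7, u7⟩, ⟨l3, u3⟩, ⟨l8, u8⟩, ⟨l2, u2⟩, ⟨l9, u9⟩⟩ : (0 ≤ x5 ∧ x5 ≤ 0) ∧ (0 ≤ x6 ∧ x6 ≤ 0) ∧ (0 ≤ x4 ∧ x4 ≤ 0) ∧ (0 ≤ x7 ∧ x7 ≤ 0) ∧ (-1 ≤ x3 ∧ x3 ≤ 1) ∧ (-1 ≤ x8 ∧ x8 ≤ 1) ∧ (-3 ≤ x2 ∧ x2 ≤ 3) ∧ (-3 ≤ x9 ∧ x9 ≤ 3) := by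
    clear k0 k1 k2 k3; refine ⟨?_, ?_, ?_, ?_, ?_, ?_, ?_, ?_⟩ <;> omega
  interval_cases x5 <;> try (exfalso; clear k0 k1 k2 k3; linarith)
  all_goals interval_cases x6 <;> try (exfalso; clear k0 k1 k2 k3; linarith)
  all_goals interval_cases x4 <;> try (exfalso; clear k0 k1 k2 k3; linarith)
  all_goals interval_cases x7 <;> try (exfalso; clear k0 k1 k2 k3; linarith)
  all_goals interval_cases x3 <;> try (exfalso; clear k0 k1 k2 k3; linarith)
  all_goals interval_cases x8 <;> try (exfalso; clear k0 k1 k2 k3; linarith)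
  all_goals interval_cases x2 <;> try (exfalso; clear k0 k1 k2 k3; linarith)
  all_goals interval_cases x9 <;> try (exfalso; clear k0 k1 k2 k3; linarith)
  all_goals omega

theorem u1_core_12 {x0 x1 x2 x3 x4 x5 x6 x7 x8 x9 x10 x11 x12 a0 a1 a2 a3 a4 a5 a6 a7 a8 a9 a10 a11 a12 : ℤ}
    (p0 : x0 ≤ a0 ∧ -x0 ≤ a0)
    (p1 : x1 ≤ a1 ∧ -x1 ≤ a1)
    (p2 : x2 ≤ a2 ∧ -x2 ≤ a2)
    (p3 : x3 ≤ a3 ∧ -x3 ≤ a3)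
    (p4 : x4 ≤ a4 ∧ -x4 ≤ a4)
    (p5 : x5 ≤ a5 ∧ -x5 ≤ a5)
    (p6 : x6 ≤ a6 ∧ -x6 ≤ a6)
    (p7 : x7 ≤ a7 ∧ -x7 ≤ a7)
    (p8 : x8 ≤ a8 ∧ -x8 ≤ a8)
    (p9 : x9 ≤ a9 ∧ -x9 ≤ a9)
    (p10 : x10 ≤ a10 ∧ -x10 ≤ a10)
    (p11 : x11 ≤ a11 ∧ -x11 ≤ a11)
    (p12 : x12 ≤ a12 ∧ -x12 ≤ a12)
    (hA : a0 + 12 * a1 + 66 * a2 + 220 * a3 + 495 * a4 + 792 * a5 + 924 * a6 + 792 * a7 + 495 * a8 + 220 * a9 + 66 * a10 + 12 * a11 + a12 < 240)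
    (k0 : x0 + 9 * x1 + 36 * x2 + 84 * x3 + 126 * x4 + 126 * x5 + 84 * x6 + 36 * x7 + 9 * x8 + x9 = 0)
    (k1 : x1 + 9 * x2 + 36 * x3 + 84 * x4 + 126 * x5 + 126 * x6 + 84 * x7 + 36 * x8 + 9 * x9 + x10 = 0)
    (k2 : x2 + 9 * x3 + 36 * x4 + 84 * x5 + 126 * x6 + 126 * x7 + 84 * x8 + 36 * x9 + 9 * x10 + x11 = 0)
    (k3 : x3 + 9 * x4 + 36 * x5 + 84 * x6 + 126 * x7 + 126 * x8 + 84 * x9 + 36 * x10 + 9 * x11 + x12 = 0)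
    : x0 = 0 ∧ x1 = 0 ∧ x2 = 0 ∧ x3 = 0 ∧ x4 = 0 ∧ x5 = 0 ∧ x6 = 0 ∧ x7 = 0 ∧ x8 = 0 ∧ x9 = 0 ∧ x10 = 0 ∧ x11 = 0 ∧ x12 = 0 := by
  cases p0; cases p1; cases p2; cases p3; cases p4; cases p5; cases p6; cases p7; cases p8; cases p9; cases p10; cases p11; cases p12
  obtain ⟨⟨l6, u6⟩, ⟨l5, u5⟩, ⟨l7, u7⟩, ⟨l4, u4⟩, ⟨l8, u8⟩, ⟨l3, u3⟩, ⟨l9, u9⟩, ⟨l2, u2⟩, ⟨l10, u10⟩⟩ : (0 ≤ x6 ∧ x6 ≤ 0) ∧ (0 ≤ x5 ∧ x5 ≤ 0) ∧ (0 ≤ x7 ∧ x7 ≤ 0) ∧ (0 ≤ x4 ∧ x4 ≤ 0) ∧ (0 ≤ x8 ∧ x8 ≤ 0) ∧ (-1 ≤ x3 ∧ x3 ≤ 1) ∧ (-1 ≤ x9 ∧ x9 ≤ 1) ∧ (-3 ≤ x2 ∧ x2 ≤ 3) ∧ (-3 ≤ x10 ∧ x10 ≤ 3) := by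
    clear k0 k1 k2 k3; refine ⟨?_, ?_, ?_, ?_, ?_, ?_, ?_, ?_, ?_⟩ <;> omega
  interval_cases x6 <;> try (exfalso; clear k0 k1 k2 k3; linarith)
  all_goals interval_cases x5 <;> try (exfalso; clear k0 k1 k2 k3; linarith)
  all_goals interval_cases x7 <;> try (exfalso; clear k0 k1 k2 k3; linarith)
  all_goals interval_cases x4 <;> try (exfalso; clear k0 k1 k2 k3; linarith)
  all_goals interval_cases x8 <;> try (exfalso; clear k0 k1 k2 k3; linarith)
  all_goals interval_cases x3 <;> try (exfalso; clear k0 k1 k2 k3; linarith)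
  all_goals interval_cases x9 <;> try (exfalso; clear k0 k1 k2 k3; linarith)
  all_goals interval_cases x2 <;> try (exfalso; clear k0 k1 k2 k3; linarith)
  all_goals interval_cases x10 <;> try (exfalso; clear k0 k1 k2 k3; linarith)
  all_goals omega

theorem u1_lower (n : ℕ) (hn : 4 ≤ n) (x : ℕ → ℤ) (hx : U1Nontrivial n x)
    (t : ℕ) (h : U1System n 3 t x) : (n : ℤ) * ((n : ℤ) - 2) ≤ t := by
  by_cases hb : 13 ≤ n
  · exact u1_big n hb x hx t h
  by_contra hlt
  push Not at hlt
  obtain ⟨hA, hB⟩ := h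
  obtain ⟨l, hl, hl0⟩ := hx
  have hA' : ∑ l ∈ Finset.range (n + 1), (n.choose l : ℤ) * |x l| < 2 * ((n : ℤ) * ((n : ℤ) - 2)) := by
    linarith
  have hB' : ∀ j < 4, ∑ i ∈ Finset.range (n - 3 + 1), ((n - 3).choose i : ℤ) * x (i + j) = 0 := by
    intro j hj
    rw [← u1_shift]
    exact hB j (by simpa using hj)
  have hl : l < n + 1 := by simpa using hl
  apply hl0
  clear hA hB hlt hl0
  have k0 := hB' 0 (by norm_num)
  have k1 := hB' 1 (by norm_num)
  have k2 := hB' 2 (by norm_num)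
  have k3 := hB' 3 (by norm_num)
  clear hB'
  interval_cases n
  all_goals simp [Finset.sum_range_succ, Nat.choose] at hA' k0 k1 k2 k3
  · have h := u1_core_4 (u1_abs (x 0)) (u1_abs (x 1)) (u1_abs (x 2)) (u1_abs (x 3)) (u1_abs (x 4))
      (by linarith) (by linarith) (by linarith) (by linarith) (by linarith)
    interval_cases l <;> simp only [h]
  · have h := u1_core_5 (u1_abs (x 0)) (u1_abs (x 1)) (u1_abs (x 2)) (u1_abs (x 3)) (u1_abs (x 4)) (u1_abs (x 5))
      (by linarith) (by linarith) (by linarith) (by linarith) (by linarith)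
    interval_cases l <;> simp only [h]
  · have h := u1_core_6 (u1_abs (x 0)) (u1_abs (x 1)) (u1_abs (x 2)) (u1_abs (x 3)) (u1_abs (x 4)) (u1_abs (x 5)) (u1_abs (x 6))
      (by linarith) (by linarith) (by linarith) (by linarith) (by linarith)
    interval_cases l <;> simp only [h]
  · have h := u1_core_7 (u1_abs (x 0)) (u1_abs (x 1)) (u1_abs (x 2)) (u1_abs (x 3)) (u1_abs (x 4)) (u1_abs (x 5)) (u1_abs (x 6)) (u1_abs (x 7))
      (by linarith) (by linarith) (by linarith) (by linarith) (by linarith)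
    interval_cases l <;> simp only [h]
  · have h := u1_core_8 (u1_abs (x 0)) (u1_abs (x 1)) (u1_abs (x 2)) (u1_abs (x 3)) (u1_abs (x 4)) (u1_abs (x 5)) (u1_abs (x 6)) (u1_abs (x 7)) (u1_abs (x 8))
      (by linarith) (by linarith) (by linarith) (by linarith) (by linarith)
    interval_cases l <;> simp only [h]
  · have h := u1_core_9 (u1_abs (x 0)) (u1_abs (x 1)) (u1_abs (x 2)) (u1_abs (x 3)) (u1_abs (x 4)) (u1_abs (x 5)) (u1_abs (x 6)) (u1_abs (x 7)) (u1_abs (x 8)) (u1_abs (x 9))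
      (by linarith) (by linarith) (by linarith) (by linarith) (by linarith)
    interval_cases l <;> simp only [h]
  · have h := u1_core_10 (u1_abs (x 0)) (u1_abs (x 1)) (u1_abs (x 2)) (u1_abs (x 3)) (u1_abs (x 4)) (u1_abs (x 5)) (u1_abs (x 6)) (u1_abs (x 7)) (u1_abs (x 8)) (u1_abs (x 9)) (u1_abs (x 10))
      (by linarith) (by linarith) (by linarith) (by linarith) (by linarith)
    interval_cases l <;> simp only [h]
  · have h := u1_core_11 (u1_abs (x 0)) (u1_abs (x 1)) (u1_abs (x 2)) (u1_abs (x 3)) (u1_abs (x 4)) (u1_abs (x 5)) (u1_abs (x 6)) (u1_abs (x 7)) (u1_abs (x 8)) (u1_abs (x 9)) (u1_abs (x 10)) (u1_abs (x 11))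
      (by linarith) (by linarith) (by linarith) (by linarith) (by linarith)
    interval_cases l <;> simp only [h]
  · have h := u1_core_12 (u1_abs (x 0)) (u1_abs (x 1)) (u1_abs (x 2)) (u1_abs (x 3)) (u1_abs (x 4)) (u1_abs (x 5)) (u1_abs (x 6)) (u1_abs (x 7)) (u1_abs (x 8)) (u1_abs (x 9)) (u1_abs (x 10)) (u1_abs (x 11)) (u1_abs (x 12))
      (by linarith) (by linarith) (by linarith) (by linarith) (by linarith)
    interval_cases l <;> simp only [h]

/-- Theorem (U(1), k = 3): no nontrivial integer solution iff `t < n(n−2)`. -/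
theorem U1_locality_three (n t : ℕ) (hn : 4 ≤ n) (ht : 0 < t) :
    (¬ ∃ x : ℕ → ℤ, U1Nontrivial n x ∧ U1System n 3 t x) ↔
      (t : ℤ) < (n : ℤ) * ((n : ℤ) - 2) := by
  constructor
  · intro h
    by_contra hlt
    push Not at hlt
    exact h (u1_exists n t hn hlt)
  · rintro h ⟨x, hx, hs⟩
    have := u1_lower n hn x hx t hs
    linarith
end

section
/- Let n ≥ 5 and t ≥ 1 be integers. The U(1) system with parameters (n,4,t) has no nontrivial integer solution if and only if t < 2(n−1)(n−3). -/
lemma u1_choose_two (p : ℕ) : ((p + 1).choose 2 : ℤ) * 2 = (p + 1) * p := by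
  induction p with
  | zero => simp
  | succ p ih =>
    rw [Nat.choose_succ_succ' (p + 1) 1]
    push_cast
    simp only [Nat.choose_one_right]
    push_cast
    linarith

lemma u1_choose_three (p : ℕ) : ((p + 2).choose 3 : ℤ) * 6 = (p + 2) * (p + 1) * p := by
  induction p with
  | zero => simp
  | succ p ih =>
    have h := u1_choose_two (p + 1)
    have e : p + 1 + 2 = (p + 2) + 1 := by ring
    rw [e, Nat.choose_succ_succ' (p + 2) 2]
    push_cast at *
    have e : p + 1 + 1 = p + 2 := by ring
    rw [e] at h
    linarith

lemma u1_choose_ge_half (n l : ℕ) (h3 : 3 ≤ l) (hl : 2 * l ≤ n) : n.choose 3 ≤ n.choose l := by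
  induction l, h3 using Nat.le_induction with
  | base => exact le_rfl
  | succ l h ih =>
    exact (ih (by omega)).trans (Nat.choose_le_succ_of_lt_half_left (by omega))

lemma u1_choose_ge (n l : ℕ) (h3 : 3 ≤ l) (hl : l + 3 ≤ n) : n.choose 3 ≤ n.choose l := by
  by_cases h : 2 * l ≤ n
  · exact u1_choose_ge_half n l h3 h
  · rw [← Nat.choose_symm (show l ≤ n by omega)]
    exact u1_choose_ge_half n (n - l) (by omega) (by omega)

/-- The `j`-th linear form, reindexed. -/
def u1E (m j : ℕ) (x : ℕ → ℤ) : ℤ := ∑ i ∈ Finset.range (m + 1), (m.choose i : ℤ) * x (i + j)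

lemma u1_sum_eq (m j : ℕ) (x : ℕ → ℤ) :
    ∑ l ∈ Finset.Icc j (m + j), (m.choose (l - j) : ℤ) * x l = u1E m j x := by
  unfold u1E
  have : Finset.Icc j (m + j) = (Finset.range (m + 1)).map (addRightEmbedding j) := by
    ext l
    simp only [Finset.mem_Icc, Finset.mem_map, Finset.mem_range, addRightEmbedding_apply]
    constructor
    · intro h
      exact ⟨l - j, by omega, by omega⟩
    · rintro ⟨a, h, rfl⟩
      omega
  rw [this, Finset.sum_map]
  simp

lemma u1_refl (m j : ℕ) (hj : j ≤ 4) (x : ℕ → ℤ) :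
    u1E m j x = u1E m (4 - j) (fun l => x (m + 4 - l)) := by
  unfold u1E
  rw [← Finset.sum_range_reflect]
  apply Finset.sum_congr rfl
  intro i hi
  rw [Finset.mem_range] at hi
  have h1 : m + 1 - 1 - i = m - i := by omega
  rw [h1, Nat.choose_symm (by omega)]
  congr 2
  omega

lemma u1_three (m j : ℕ) (x : ℕ → ℤ) (h : ∀ l, 3 + j ≤ l → l ≤ m + j → x l = 0) :
    u1E m j x = x j + m * x (j + 1) + m.choose 2 * x (j + 2) := by
  unfold u1E
  have h1 : ∑ i ∈ Finset.range (m + 1), (m.choose i : ℤ) * x (i + j)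
      = ∑ i ∈ Finset.range (m + 3), (m.choose i : ℤ) * x (i + j) := by
    apply Finset.sum_subset
    · intro i; simp only [Finset.mem_range]; omega
    · intro i _ hi
      rw [Finset.mem_range] at hi
      rw [Nat.choose_eq_zero_of_lt (by omega)]; simp
  have h2 : ∑ i ∈ Finset.range 3, (m.choose i : ℤ) * x (i + j)
      = ∑ i ∈ Finset.range (m + 3), (m.choose i : ℤ) * x (i + j) := by
    apply Finset.sum_subset
    · intro i; simp only [Finset.mem_range]; omega
    · intro i _ hi
      rw [Finset.mem_range] at hi
      by_cases hm : i ≤ m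
      · rw [h _ (by omega) (by omega)]; simp
      · rw [Nat.choose_eq_zero_of_lt (by omega)]; simp
  rw [h1, ← h2]
  simp [Finset.sum_range_succ, add_comm]

lemma u1_E0 (m : ℕ) (x : ℕ → ℤ) (h : ∀ l, 3 ≤ l → l ≤ m + 1 → x l = 0) :
    u1E m 0 x = x 0 + m * x 1 + m.choose 2 * x 2 := by
  simpa using u1_three m 0 x (fun l h1 h2 => h l (by omega) (by omega))

lemma u1_E1 (m : ℕ) (hm : 1 ≤ m) (x : ℕ → ℤ) (h : ∀ l, 3 ≤ l → l ≤ m + 1 → x l = 0) :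
    u1E m 1 x = x 1 + m * x 2 := by
  rw [u1_three m 1 x (fun l h1 h2 => h l (by omega) (by omega))]
  by_cases h1 : m = 1
  · subst h1; simp
  · rw [h (1 + 2) (by omega) (by omega)]; simp

lemma u1_E2 (m : ℕ) (hm : 1 ≤ m) (x : ℕ → ℤ) (h : ∀ l, 3 ≤ l → l ≤ m + 1 → x l = 0) :
    u1E m 2 x = x 2 + x (m + 2) := by
  unfold u1E
  have h2 : ∑ i ∈ ({0, m} : Finset ℕ), (m.choose i : ℤ) * x (i + 2)
      = ∑ i ∈ Finset.range (m + 1), (m.choose i : ℤ) * x (i + 2) := by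
    apply Finset.sum_subset
    · intro i; simp only [Finset.mem_range, Finset.mem_insert, Finset.mem_singleton]; omega
    · intro i hi hi2
      simp only [Finset.mem_range, Finset.mem_insert, Finset.mem_singleton] at hi hi2
      rw [h _ (by omega) (by omega)]; simp
  rw [← h2, Finset.sum_pair (by omega)]
  simp

lemma u1_six (m : ℕ) (hm : 1 ≤ m) (f : ℕ → ℤ) :
    ∑ l ∈ ({0, 1, 2, m + 2, m + 3, m + 4} : Finset ℕ), f l
      = f 0 + f 1 + f 2 + f (m + 2) + f (m + 3) + f (m + 4) := by
  rw [Finset.sum_insert, Finset.sum_insert, Finset.sum_insert, Finset.sum_insert,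
    Finset.sum_insert, Finset.sum_singleton]
  · ring
  all_goals simp only [Finset.mem_insert, Finset.mem_singleton]; omega

lemma u1_six_le (m : ℕ) (hm : 1 ≤ m) (f : ℕ → ℤ) (hf : ∀ l, 0 ≤ f l) :
    f 0 + f 1 + f 2 + f (m + 2) + f (m + 3) + f (m + 4) ≤ ∑ l ∈ Finset.range (m + 4 + 1), f l := by
  rw [← u1_six m hm]
  apply Finset.sum_le_sum_of_subset_of_nonneg
  · intro i; simp only [Finset.mem_range, Finset.mem_insert, Finset.mem_singleton]; omega
  · intro i _ _; exact hf i

lemma u1_six_eq (m : ℕ) (hm : 1 ≤ m) (f : ℕ → ℤ) (hf : ∀ l, 3 ≤ l → l ≤ m + 1 → f l = 0) :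
    ∑ l ∈ Finset.range (m + 4 + 1), f l = f 0 + f 1 + f 2 + f (m + 2) + f (m + 3) + f (m + 4) := by
  rw [← u1_six m hm]
  symm
  apply Finset.sum_subset
  · intro i; simp only [Finset.mem_range, Finset.mem_insert, Finset.mem_singleton]; omega
  · intro i h1 h2
    simp only [Finset.mem_range, Finset.mem_insert, Finset.mem_singleton] at h1 h2
    exact hf i (by omega) (by omega)

lemma u1_sys (m t : ℕ) (x : ℕ → ℤ) : U1System (m + 4) 4 t x ↔
    (∑ l ∈ Finset.range (m + 4 + 1), ((m + 4).choose l : ℤ) * |x l| ≤ 2 * (t : ℤ)) ∧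
    u1E m 0 x = 0 ∧ u1E m 1 x = 0 ∧ u1E m 2 x = 0 ∧ u1E m 3 x = 0 ∧ u1E m 4 x = 0 := by
  unfold U1System
  simp only [Nat.add_sub_cancel, u1_sum_eq]
  apply and_congr_right
  intro _
  constructor
  · intro h
    simp only [Finset.mem_range] at h
    exact ⟨h 0 (by omega), h 1 (by omega), h 2 (by omega), h 3 (by omega), h 4 (by omega)⟩
  · rintro ⟨h0, h1, h2, h3, h4⟩ j hj
    rw [Finset.mem_range] at hj
    interval_cases j <;> assumption

/-- Pascal-type step for the linear forms. -/
lemma u1_step (m j : ℕ) (x : ℕ → ℤ) : u1E (m + 1) j x = u1E m j x + u1E m (j + 1) x := by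
  unfold u1E
  rw [Finset.sum_range_succ']
  have h1 : ∀ i, ((m + 1).choose (i + 1) : ℤ) * x (i + 1 + j)
      = (m.choose i : ℤ) * x (i + (j + 1)) + (m.choose (i + 1) : ℤ) * x (i + 1 + j) := by
    intro i
    rw [Nat.choose_succ_succ' m i, show i + (j + 1) = i + 1 + j by ring]
    push_cast
    ring
  simp only [h1]
  rw [Finset.sum_add_distrib, Finset.sum_range_succ (fun i => (m.choose (i + 1) : ℤ) * x (i + 1 + j)),
    Finset.sum_range_succ' (fun i => (m.choose i : ℤ) * x (i + j))]
  simp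
  ring

/-- The total weighted sum vanishes. -/
lemma u1_total (m : ℕ) (x : ℕ → ℤ) (h0 : u1E m 0 x = 0) (h1 : u1E m 1 x = 0)
    (h2 : u1E m 2 x = 0) (h3 : u1E m 3 x = 0) (h4 : u1E m 4 x = 0) :
    ∑ l ∈ Finset.range (m + 4 + 1), ((m + 4).choose l : ℤ) * x l = 0 := by
  have : u1E (m + 4) 0 x = 0 := by
    simp [u1_step, h0, h1, h2, h3, h4]
  simpa [u1E] using this

lemma u1_twice (n l : ℕ) (y : ℕ → ℤ) (hl : l ∈ Finset.range (n + 1))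
    (h : ∑ i ∈ Finset.range (n + 1), y i = 0) :
    2 * |y l| ≤ ∑ i ∈ Finset.range (n + 1), |y i| := by
  rw [← Finset.add_sum_erase _ _ hl] at h ⊢
  have h2 := Finset.abs_sum_le_sum_abs y ((Finset.range (n + 1)).erase l)
  have h3 : |y l| = |∑ i ∈ (Finset.range (n + 1)).erase l, y i| := by
    rw [eq_neg_of_add_eq_zero_left h, abs_neg]
  linarith

lemma u1_mid_large (m l : ℕ) (hm : 7 ≤ m) (x : ℕ → ℤ) (hl3 : 3 ≤ l) (hl : l ≤ m + 1)
    (hx : x l ≠ 0)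
    (h0 : u1E m 0 x = 0) (h1 : u1E m 1 x = 0)
    (h2 : u1E m 2 x = 0) (h3 : u1E m 3 x = 0) (h4 : u1E m 4 x = 0) :
    4 * ((m : ℤ) + 3) * (m + 1) ≤ ∑ l ∈ Finset.range (m + 4 + 1), ((m + 4).choose l : ℤ) * |x l| := by
  have ht := u1_total m x h0 h1 h2 h3 h4
  have h5 := u1_twice (m + 4) l _ (by simp; omega) ht
  simp only [abs_mul, Nat.abs_cast] at h5
  have hx1 : 1 ≤ |x l| := Int.one_le_abs hx
  have hc : (((m + 4).choose 3 : ℕ) : ℤ) ≤ ((m + 4).choose l : ℕ) := by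
    exact_mod_cast u1_choose_ge (m + 4) l hl3 (by omega)
  have hc3 := u1_choose_three (m + 2)
  rw [show m + 2 + 2 = m + 4 by ring] at hc3
  push_cast at hc3
  have hm' : (7 : ℤ) ≤ m := by exact_mod_cast hm
  have h6 : ((m + 4).choose l : ℤ) ≤ ((m + 4).choose l : ℤ) * |x l| := by
    nlinarith [Int.natCast_nonneg ((m + 4).choose l)]
  have h7 : 12 * ((m : ℤ) + 1) ≤ (m + 4) * (m + 2) := by nlinarith
  nlinarith

lemma u1_tri (a : ℤ) (h1 : -2 < a) (h2 : a < 2) : a = -1 ∨ a = 0 ∨ a = 1 := by omega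

lemma u1_quint (a : ℤ) (h1 : -3 < a) (h2 : a < 3) :
    a = -2 ∨ a = -1 ∨ a = 0 ∨ a = 1 ∨ a = 2 := by omega

set_option maxHeartbeats 4000000 in
lemma u1_mid_small (m l : ℕ) (hm : m ≤ 6) (x : ℕ → ℤ) (hl3 : 3 ≤ l) (hl : l ≤ m + 1)
    (hx : x l ≠ 0)
    (h0 : u1E m 0 x = 0) (h1 : u1E m 1 x = 0)
    (h2 : u1E m 2 x = 0) (h3 : u1E m 3 x = 0) (h4 : u1E m 4 x = 0) :
    4 * ((m : ℤ) + 3) * (m + 1) ≤ ∑ l ∈ Finset.range (m + 4 + 1), ((m + 4).choose l : ℤ) * |x l| := by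
  have ha := fun i => le_abs_self (x i)
  have hb := fun i => neg_le_abs (x i)
  unfold u1E at *
  have h2m : 2 ≤ m := by omega
  interval_cases m <;> interval_cases l <;>
  · simp only [Finset.sum_range_succ, Finset.sum_range_zero] at *
    norm_num [Nat.choose] at *
    have a0 := ha 0
    have a1 := ha 1
    have a2 := ha 2
    have a3 := ha 3
    have a4 := ha 4
    have a5 := ha 5
    have a6 := ha 6
    have a7 := ha 7
    have a8 := ha 8
    have a9 := ha 9
    have a10 := ha 10
    have b0 := hb 0
    have b1 := hb 1
    have b2 := hb 2
    have b3 := hb 3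
    have b4 := hb 4
    have b5 := hb 5
    have b6 := hb 6
    have b7 := hb 7
    have b8 := hb 8
    have b9 := hb 9
    have b10 := hb 10
    clear ha hb
    first
    | (rcases lt_or_gt_of_ne hx with hx | hx
       · have hx' := Int.add_one_le_of_lt hx
         linarith
       · have hx' := Int.add_one_le_of_lt hx
         linarith)
    | (by_contra hlt
       rw [not_le] at hlt
       have u3 := u1_tri (x 3) (by linarith) (by linarith)
       have u4 := u1_tri (x 4) (by linarith) (by linarith)
       have u2 := u1_quint (x 2) (by linarith) (by linarith)
       first
       | (have v4 : x 4 = 0 := by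
            rcases u4 with u | u | u
            · exfalso; linarith
            · exact u
            · exfalso; linarith
          have v5 : x 5 = 0 := by
            rcases u1_tri (x 5) (by linarith) (by linarith) with u | u | u
            · exfalso; linarith
            · exact u
            · exfalso; linarith
          have u6 := u1_tri (x 6) (by linarith) (by linarith)
          rcases u3 with u3 | u3 | u3 <;> rcases u6 with u6 | u6 | u6 <;>
            first | omega | linarith |
              (rcases u2 with u2 | u2 | u2 | u2 | u2 <;> linarith))
       | (have v4 : x 4 = 0 := by
            rcases u4 with u | u | u
            · exfalso; linarith
            · exact u
            · exfalso; linarith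
          have u5 := u1_tri (x 5) (by linarith) (by linarith)
          rcases u3 with u3 | u3 | u3 <;> rcases u5 with u5 | u5 | u5 <;>
            first | omega | linarith |
              (rcases u2 with u2 | u2 | u2 | u2 | u2 <;> linarith))
       | (rcases u3 with u3 | u3 | u3 <;> rcases u4 with u4 | u4 | u4 <;>
            first | omega | linarith |
              (rcases u2 with u2 | u2 | u2 | u2 | u2 <;> linarith)))

lemma u1_edge (m : ℕ) (hm : 1 ≤ m) (x : ℕ → ℤ) (hz : ∀ l, 3 ≤ l → l ≤ m + 1 → x l = 0)
    (hx : U1Nontrivial (m + 4) x)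
    (h0 : u1E m 0 x = 0) (h1 : u1E m 1 x = 0)
    (h2 : u1E m 2 x = 0) (h3 : u1E m 3 x = 0) (h4 : u1E m 4 x = 0) :
    4 * ((m : ℤ) + 3) * (m + 1) ≤ ∑ l ∈ Finset.range (m + 4 + 1), ((m + 4).choose l : ℤ) * |x l| := by
  have hz' : ∀ l, 3 ≤ l → l ≤ m + 1 → (fun l => x (m + 4 - l)) l = 0 :=
    fun l _ _ => hz _ (by omega) (by omega)
  rw [u1_E0 m x hz] at h0
  rw [u1_E1 m hm x hz] at h1
  rw [u1_E2 m hm x hz] at h2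
  rw [u1_refl m 3 (by omega), u1_E1 m hm _ hz'] at h3
  rw [u1_refl m 4 (by omega), u1_E0 m _ hz'] at h4
  simp only [show m + 4 - 0 = m + 4 by omega, show m + 4 - 1 = m + 3 by omega,
    show m + 4 - 2 = m + 2 by omega] at h3 h4
  obtain ⟨p, rfl⟩ : ∃ p, m = p + 1 := ⟨m - 1, by omega⟩
  have c1 := u1_choose_two p
  have c2 := u1_choose_two (p + 4)
  rw [show p + 4 + 1 = p + 1 + 4 by ring] at c2
  refine le_trans ?_ (u1_six_le (p + 1) hm _ (fun l => by positivity))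
  have s1 : (p + 1 + 4).choose (p + 1 + 2) = (p + 1 + 4).choose 2 :=
    Nat.choose_symm_of_eq_add (by ring)
  have s2 : (p + 1 + 4).choose (p + 1 + 3) = p + 1 + 4 := by
    rw [Nat.choose_symm_of_eq_add (show p + 1 + 4 = (p + 1 + 3) + 1 by ring)]; simp
  rw [s1, s2]
  simp only [Nat.choose_zero_right, Nat.choose_one_right, Nat.choose_self]
  have e1 : x 1 = -((p : ℤ) + 1) * x 2 := by push_cast at h1; linarith
  have e5 : x (p + 1 + 2) = - x 2 := by linarith
  have e4 : x (p + 1 + 3) = ((p : ℤ) + 1) * x 2 := by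
    rw [e5] at h3; push_cast at h3; linarith
  have e0 : 2 * x 0 = ((p : ℤ) + 1) * (p + 2) * x 2 := by
    rw [e1] at h0; push_cast at h0; linear_combination 2 * h0 - x 2 * c1
  have e6 : 2 * x (p + 1 + 4) = -(((p : ℤ) + 1) * (p + 2)) * x 2 := by
    rw [e4, e5] at h4; push_cast at h4; linear_combination 2 * h4 + x 2 * c1
  have hp : (0 : ℤ) ≤ p := Int.natCast_nonneg p
  have hc : x 2 ≠ 0 := by
    intro hc
    rw [hc] at e0 e1 e4 e5 e6
    obtain ⟨l, hl, hl2⟩ := hx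
    rw [Finset.mem_range] at hl
    apply hl2
    by_cases hl3 : 3 ≤ l ∧ l ≤ p + 1 + 1
    · exact hz l hl3.1 hl3.2
    · have : l = 0 ∨ l = 1 ∨ l = 2 ∨ l = p + 1 + 2 ∨ l = p + 1 + 3 ∨ l = p + 1 + 4 := by omega
      rcases this with rfl | rfl | rfl | rfl | rfl | rfl <;> linarith
  have hc1 : 1 ≤ |x 2| := Int.one_le_abs hc
  have a1 : |x 1| = ((p : ℤ) + 1) * |x 2| := by
    rw [e1, abs_mul, abs_neg, abs_of_nonneg (by positivity)]
  have a5 : |x (p + 1 + 2)| = |x 2| := by rw [e5, abs_neg]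
  have a4 : |x (p + 1 + 3)| = ((p : ℤ) + 1) * |x 2| := by
    rw [e4, abs_mul, abs_of_nonneg (by positivity)]
  have a0 : 2 * |x 0| = ((p : ℤ) + 1) * (p + 2) * |x 2| := by
    have := congrArg abs e0
    rwa [abs_mul, abs_mul (((p : ℤ) + 1) * (p + 2)), abs_of_nonneg (show (0 : ℤ) ≤ ((p : ℤ) + 1) * (p + 2) by positivity), abs_two] at this
  have a6 : 2 * |x (p + 1 + 4)| = ((p : ℤ) + 1) * (p + 2) * |x 2| := by
    have := congrArg abs e6
    rwa [abs_mul, abs_mul, abs_neg, abs_of_nonneg (show (0 : ℤ) ≤ ((p : ℤ) + 1) * (p + 2) by positivity), abs_two] at this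
  rw [a1, a4, a5]
  push_cast at *
  have key : 2 * (4 * ((p : ℤ) + 1 + 3) * (p + 1 + 1) * |x 2|) =
    2 * (1 * |x 0| + ((p : ℤ) + 1 + 4) * ((p + 1) * |x 2|) + ((p + 1 + 4).choose 2 : ℤ) * |x 2|
      + ((p + 1 + 4).choose 2 : ℤ) * |x 2| + ((p : ℤ) + 1 + 4) * ((p + 1) * |x 2|)
      + 1 * |x (p + 1 + 4)|) := by
    linear_combination -a0 - a6 - 2 * |x 2| * c2
  have h8 : 4 * ((p : ℤ) + 1 + 3) * (p + 1 + 1) * 1 ≤ 4 * ((p : ℤ) + 1 + 3) * (p + 1 + 1) * |x 2| :=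
    mul_le_mul_of_nonneg_left hc1 (by positivity)
  linarith

/-- The extremal solution. -/
def u1X (m l : ℕ) : ℤ :=
  if l = 0 then ((m + 1).choose 2 : ℤ) else if l = 1 then -(m : ℤ) else if l = 2 then 1
  else if l = m + 2 then -1 else if l = m + 3 then (m : ℤ)
  else if l = m + 4 then -((m + 1).choose 2 : ℤ) else 0

lemma u1_exists_s8 (m t : ℕ) (hm : 1 ≤ m) (ht : 2 * ((m : ℤ) + 3) * (m + 1) ≤ t) :
    U1Nontrivial (m + 4) (u1X m) ∧ U1System (m + 4) 4 t (u1X m) := by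
  have x0 : u1X m 0 = ((m + 1).choose 2 : ℤ) := by simp [u1X]
  have x1 : u1X m 1 = -(m : ℤ) := by simp [u1X]
  have x2 : u1X m 2 = 1 := by simp [u1X]
  have x5 : u1X m (m + 2) = -1 := by
    unfold u1X
    rw [if_neg (by omega), if_neg (by omega), if_neg (by omega), if_pos rfl]
  have x4 : u1X m (m + 3) = m := by
    unfold u1X
    rw [if_neg (by omega), if_neg (by omega), if_neg (by omega), if_neg (by omega), if_pos rfl]
  have x6 : u1X m (m + 4) = -((m + 1).choose 2 : ℤ) := by
    unfold u1X
    rw [if_neg (by omega), if_neg (by omega), if_neg (by omega), if_neg (by omega),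
      if_neg (by omega), if_pos rfl]
  have hz : ∀ l, 3 ≤ l → l ≤ m + 1 → u1X m l = 0 := by
    intro l h1 h2
    unfold u1X
    rw [if_neg (by omega), if_neg (by omega), if_neg (by omega), if_neg (by omega),
      if_neg (by omega), if_neg (by omega)]
  have hz' : ∀ l, 3 ≤ l → l ≤ m + 1 → (fun l => u1X m (m + 4 - l)) l = 0 :=
    fun l _ _ => hz _ (by omega) (by omega)
  refine ⟨⟨2, by simp, by rw [x2]; simp⟩, ?_⟩
  rw [u1_sys, u1_E0 m _ hz, u1_E1 m hm _ hz, u1_E2 m hm _ hz,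
    u1_refl m 3 (by omega), u1_E1 m hm _ hz', u1_refl m 4 (by omega), u1_E0 m _ hz',
    u1_six_eq m hm _ (fun l h1 h2 => by rw [hz l h1 h2]; simp)]
  simp only [show m + 4 - 0 = m + 4 by omega, show m + 4 - 1 = m + 3 by omega,
    show m + 4 - 2 = m + 2 by omega, x0, x1, x2, x4, x5, x6]
  have s1 : (m + 4).choose (m + 2) = (m + 4).choose 2 :=
    Nat.choose_symm_of_eq_add (by ring)
  have s2 : (m + 4).choose (m + 3) = m + 4 := by
    rw [Nat.choose_symm_of_eq_add (show m + 4 = (m + 3) + 1 by ring)]; simp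
  have c2 := u1_choose_two (m + 3)
  rw [show m + 3 + 1 = m + 4 by ring] at c2
  have c1 := u1_choose_two m
  have c3 : ((m + 1).choose 2 : ℤ) = m + m.choose 2 := by
    rw [Nat.choose_succ_succ' m 1]; simp
  have c0 : (m.choose 2 : ℤ) * 2 = m * (m - 1) := by
    rw [c3] at c1; linarith
  rw [s1, s2]
  simp only [Nat.choose_zero_right, Nat.choose_one_right, Nat.choose_self, abs_neg, abs_one,
    Nat.abs_cast]
  push_cast at *
  refine ⟨by nlinarith, by nlinarith, by norm_num, by norm_num, by norm_num, by nlinarith⟩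

/-- Theorem (U(1), k = 4): no nontrivial integer solution iff `t < 2(n−1)(n−3)`. -/
theorem U1_locality_four (n t : ℕ) (hn : 5 ≤ n) (ht : 0 < t) :
    (¬ ∃ x : ℕ → ℤ, U1Nontrivial n x ∧ U1System n 4 t x) ↔
      (t : ℤ) < 2 * ((n : ℤ) - 1) * ((n : ℤ) - 3) := by
  obtain ⟨m, rfl⟩ : ∃ m, n = m + 4 := ⟨n - 4, by omega⟩
  have hm : 1 ≤ m := by omega
  have e : 2 * (((m + 4 : ℕ) : ℤ) - 1) * (((m + 4 : ℕ) : ℤ) - 3) = 2 * ((m : ℤ) + 3) * (m + 1) := by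
    push_cast; ring
  rw [e]
  constructor
  · intro h
    by_contra hlt
    exact h ⟨u1X m, u1_exists_s8 m t hm (not_lt.mp hlt)⟩
  · rintro hlt ⟨x, hx, hs⟩
    rw [u1_sys] at hs
    obtain ⟨hA, h0, h1, h2, h3, h4⟩ := hs
    have key : 4 * ((m : ℤ) + 3) * (m + 1)
        ≤ ∑ l ∈ Finset.range (m + 4 + 1), ((m + 4).choose l : ℤ) * |x l| := by
      by_cases hz : ∀ l, 3 ≤ l → l ≤ m + 1 → x l = 0
      · exact u1_edge m hm x hz hx h0 h1 h2 h3 h4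
      · push Not at hz
        obtain ⟨l, hl3, hl, hxl⟩ := hz
        by_cases hm7 : 7 ≤ m
        · exact u1_mid_large m l hm7 x hl3 hl hxl h0 h1 h2 h3 h4
        · exact u1_mid_small m l (by omega) x hl3 hl hxl h0 h1 h2 h3 h4
    linarith
end
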